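/- arXiv:1902.06319 — 5 statements merged into one kernel-verified Lean document; each statement's English description precedes it below -/
import Mathlib

section
/- Let F_q be a finite field with q elements. For every a ∈ F_q there exist vectors u, v ∈ F_q^5 such that the inner product Σ_{ℓ=1}^{5} u_ℓ v_ℓ = a, while Σ_{ℓ=1}^{5} u_ℓ² = 0 and Σ_{ℓ=1}^{5} v_ℓ² = 0. -/
/-- In a finite field `F` (with `q` elements), for every `a ∈ F` there are
vectors `u, v ∈ F^5` with inner product `⟨u,v⟩ = a` while `⟨u,u⟩ = 0` and `⟨v,v⟩ = 0`. -/
theorem stmt0 (F : Type*) [Field F] [Fintype F] (a : F) :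
    ∃ u v : Fin 5 → F,
      (∑ ℓ, u ℓ * v ℓ = a) ∧ (∑ ℓ, u ℓ ^ 2 = 0) ∧ (∑ ℓ, v ℓ ^ 2 = 0) := by
  obtain ⟨p, _⟩ := CharP.exists F
  have : NeZero p := ⟨CharP.char_ne_zero_of_finite F p⟩
  obtain ⟨b, c, h⟩ := CharP.sq_add_sq F p (-1)
  push_cast at h
  refine ⟨![a, a * b, a * c, 0, 0], ![1, 0, 0, b, c], ?_, ?_, ?_⟩
  · simp [Fin.sum_univ_five]
  · simp only [Fin.sum_univ_five, Matrix.cons_val]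
    linear_combination a ^ 2 * h
  · simp only [Fin.sum_univ_five, Matrix.cons_val]
    linear_combination h
end

section
/- Let F_q be a finite field with q elements, let K ≥ 1, fix indices i ≤ j in {1,…,K} and a ∈ F_q. Then there exist vectors w_1,…,w_K ∈ F_q^5 such that ⟨w_i,w_j⟩ = a and ⟨w_k,w_l⟩ = 0 for every pair k ≤ l in {1,…,K} with (k,l) ≠ (i,j). -/
open Polynomial in
/-- Every element of a finite field is a sum of two squares. -/
theorem FiniteField.exists_sq_add_sq_eq {F : Type*} [Field F] [Finite F] (a : F) :
    ∃ x y : F, x ^ 2 + y ^ 2 = a := by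
  have := Fintype.ofFinite F
  by_cases h : ringChar F = 2
  · obtain ⟨x, hx⟩ := FiniteField.isSquare_of_char_two h a
    exact ⟨x, 0, by rw [hx]; ring⟩
  · obtain ⟨x, y, hxy⟩ := FiniteField.exists_root_sum_quadratic
      (f := (X ^ 2 : F[X])) (g := (X ^ 2 - C a : F[X])) (degree_X_pow 2)
      (degree_X_pow_sub_C (by decide) a)
      (FiniteField.odd_card_of_char_ne_two h)
    refine ⟨x, y, ?_⟩
    simp only [eval_pow, eval_X, eval_sub, eval_C] at hxy
    linear_combination hxy

/-- Over a finite field, the standard form in dimension five has pairs of isotropic vectors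
with any prescribed inner product. -/
theorem FiniteField.exists_isotropic_pair {F : Type*} [Field F] [Finite F] (a : F) :
    ∃ u v : Fin 5 → F, ∑ ℓ, u ℓ * v ℓ = a ∧ ∑ ℓ, u ℓ * u ℓ = 0 ∧ ∑ ℓ, v ℓ * v ℓ = 0 := by
  by_cases h : (2 : F) = 0
  · refine ⟨![1, 1, 0, 0, 0], ![0, a, a, 0, 0], ?_, ?_, ?_⟩ <;>
      simp only [Fin.sum_univ_five] <;> simp
    · linear_combination h
    · linear_combination a ^ 2 * h
  · obtain ⟨x, y, hxy⟩ := FiniteField.exists_sq_add_sq_eq (-1 : F)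
    refine ⟨![1, x, y, 0, 0], ![a / 2, -(a / 2) * x, -(a / 2) * y, 0, 0], ?_, ?_, ?_⟩ <;>
      simp only [Fin.sum_univ_five] <;> simp
    · field_simp
      linear_combination -a * hxy
    · linear_combination hxy
    · linear_combination (a / 2) ^ 2 * hxy

/-- In a finite field `F`, for `K ≥ 1`, fixed indices `i ≤ j` in `{1,…,K}` and
`a ∈ F`, there exist vectors `w_1, …, w_K ∈ F^5` such that `⟨w_i, w_j⟩ = a` and
`⟨w_k, w_l⟩ = 0` for every other pair `k ≤ l`. -/
theorem stmt1 (F : Type*) [Field F] [Fintype F] (K : ℕ) (hK : 1 ≤ K)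
    (i j : Fin K) (hij : i ≤ j) (a : F) :
    ∃ w : Fin K → Fin 5 → F,
      (∑ ℓ, w i ℓ * w j ℓ = a) ∧
      (∀ k l : Fin K, k ≤ l → (k, l) ≠ (i, j) → ∑ ℓ, w k ℓ * w l ℓ = 0) := by
  rcases hij.eq_or_lt with rfl | hlt
  · obtain ⟨x, y, hxy⟩ := FiniteField.exists_sq_add_sq_eq a
    refine ⟨fun k => if k = i then ![x, y, 0, 0, 0] else 0, ?_, fun k l _ hne => ?_⟩
    · simp [Fin.sum_univ_five, ← hxy, pow_two]
    · by_cases hk : k = i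
      · have hl : l ≠ i := fun hl => hne (by rw [hk, hl])
        simp [hl]
      · simp [hk]
  · obtain ⟨u, v, huv, hu, hv⟩ := FiniteField.exists_isotropic_pair a
    refine ⟨fun k => if k = i then u else if k = j then v else 0, ?_, fun k l hkl hne => ?_⟩
    · simpa [hlt.ne'] using huv
    · by_cases hki : k = i
      · subst hki
        have hl : l ≠ j := fun hl => hne (by rw [hl])
        by_cases hlk : l = k
        · simpa [hlk] using hu
        · simp [hl, hlk]
      · by_cases hkj : k = j
        · subst hkj
          have hli : l ≠ i := (hlt.trans_le hkl).ne'
          by_cases hlk : l = k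
          · simpa [hlk, hki] using hv
          · simp [hlk, hli]
        · simp [hki, hkj]
end

section
/- Let F_q be a finite field with q elements, let K ≥ 1, let m = K(K+1)/2 and Γ = 5m. Then the Gram map (F_q^Γ)^K → F_q^m sending (w_1,…,w_K) to (⟨w_i,w_j⟩)_{1≤i≤j≤K} is surjective: for every y ∈ F_q^m there exist w_1,…,w_K ∈ F_q^Γ with ⟨w_i,w_j⟩ = y_{\{i,j\}} for all 1 ≤ i ≤ j ≤ K. -/
open Polynomial in
/-- Every element of a finite field is a sum of two squares. -/
theorem FiniteField.exists_mul_self_add_mul_self (F : Type*) [Field F] [Fintype F] (x : F) :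
    ∃ a b : F, a * a + b * b = x := by
  by_cases hF : ringChar F = 2
  · obtain ⟨a, ha⟩ := FiniteField.isSquare_of_char_two hF x
    exact ⟨a, 0, by simp [ha]⟩
  · obtain ⟨a, b, hab⟩ := FiniteField.exists_root_sum_quadratic (f := (X ^ 2 : F[X]))
      (g := X ^ 2 - C x) (degree_X_pow 2) (degree_X_pow_sub_C (by norm_num) x)
      (FiniteField.odd_card_of_char_ne_two hF)
    simp only [eval_pow, eval_X, eval_sub, eval_C] at hab
    exact ⟨a, b, by linear_combination hab⟩

/-- Vectors indexed by `ι × ι ⊕ ι ⊕ ι` over a finite field realise any prescribed symmetric Gram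
matrix. -/
theorem FiniteField.exists_gram_eq (F : Type*) [Field F] [Fintype F] {ι : Type*} [Fintype ι]
    [LinearOrder ι] (y : ι → ι → F) :
    ∃ v : ι → (ι × ι) ⊕ (ι ⊕ ι) → F, ∀ i j, i ≤ j → ∑ s, v i s * v j s = y i j := by
  let c : ι → ι × ι → F := fun i p ↦
    if i = p.1 then 1 else if i = p.2 ∧ p.1 < p.2 then y p.1 p.2 else 0
  choose a b hab using fun i ↦
    FiniteField.exists_mul_self_add_mul_self F (y i i - ∑ p, c i p * c i p)
  refine ⟨fun i ↦ Sum.elim (c i) (Sum.elim (Pi.single i (a i)) (Pi.single i (b i))), ?_⟩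
  intro i j hij
  simp only [Fintype.sum_sum_type, Sum.elim_inl, Sum.elim_inr]
  obtain rfl | hlt := hij.eq_or_lt
  · simp [Pi.single_apply, hab]
  · have h : ∑ p, c i p * c j p = y i j := by
      rw [Finset.sum_eq_single (i, j)]
      · simp [c, hlt, hlt.ne']
      · rintro ⟨p, q⟩ - hpq
        simp only [c, ne_eq, Prod.mk.injEq] at hpq ⊢
        grind
      · simp
    simp [h, Pi.single_apply, hlt.ne']

/-- In a finite field `F`, for `K ≥ 1`, `m = K(K+1)/2` and `Γ = 5m`, the Gram
map `(F^Γ)^K → F^m`, `(w_1,…,w_K) ↦ (⟨w_i,w_j⟩)_{1 ≤ i ≤ j ≤ K}`, is surjective. -/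
theorem stmt2 (F : Type*) [Field F] [Fintype F] (K : ℕ) (hK : 1 ≤ K)
    (y : {p : Fin K × Fin K // p.1 ≤ p.2} → F) :
    ∃ w : Fin K → Fin (5 * (K * (K + 1) / 2)) → F,
      ∀ p : {p : Fin K × Fin K // p.1 ≤ p.2},
        ∑ ℓ, w p.1.1 ℓ * w p.1.2 ℓ = y p := by
  obtain ⟨v, hv⟩ := FiniteField.exists_gram_eq F
    fun i j : Fin K ↦ if h : i ≤ j then y ⟨(i, j), h⟩ else 0
  have hcard : Fintype.card ((Fin K × Fin K) ⊕ (Fin K ⊕ Fin K)) ≤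
      Fintype.card (Fin (5 * (K * (K + 1) / 2))) := by
    simp only [Fintype.card_sum, Fintype.card_prod, Fintype.card_fin]
    have := Nat.div_mul_cancel (Nat.even_mul_succ_self K).two_dvd
    nlinarith
  obtain ⟨e⟩ := Function.Embedding.nonempty_of_card_le hcard
  refine ⟨fun i ↦ Function.extend e (v i) 0, ?_⟩
  rintro ⟨⟨i, j⟩, hij⟩
  rw [← Fintype.sum_of_injective e e.injective (fun s ↦ v i s * v j s), hv i j hij]
  · exact dif_pos hij
  · intro ℓ hℓ
    simp [Function.extend_apply' _ _ _ hℓ]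
  · simp [e.injective.extend_apply]
end

section
/- Let F_q be a finite field with q elements, K ≥ 1, m = K(K+1)/2. For each L ≥ 1 let W_1,…,W_K be independent uniform random vectors on F_q^L and X^{(L)} = (⟨W_i,W_j⟩)_{1≤i≤j≤K} their Gram vector. Then for every y ∈ F_q^m, lim_{L→∞} Pr{X^{(L)} = y} = q^{−m}; i.e., the distribution of X^{(L)} converges to the uniform distribution on F_q^m. -/
open Filter

/-- An additive character sends sums to products. -/
theorem AddChar.map_sum_finset {G M ι : Type*} [AddCommMonoid G] [CommMonoid M]
    (ψ : AddChar G M) (s : Finset ι) (f : ι → G) : ψ (∑ i ∈ s, f i) = ∏ i ∈ s, ψ (f i) :=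
  map_prod ψ.toMonoidHom (fun i => Multiplicative.ofAdd (f i)) s

/-- A character that is trivial at some but not all values of `g` has a nontrivial sum over `g`. -/
theorem AddChar.norm_sum_comp_lt_card {G W : Type*} [AddCommGroup G] [Finite G] [Fintype W]
    (ψ : AddChar G ℂ) (g : W → G) (h₀ : ∃ w, ψ (g w) = 1) (h₁ : ∃ w, ψ (g w) ≠ 1) :
    ‖∑ w, ψ (g w)‖ < Fintype.card W := by
  classical
  obtain ⟨a, ha⟩ := h₀
  obtain ⟨b, hb⟩ := h₁
  have hab : b ≠ a := by rintro rfl; exact hb ha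
  have hlt : ‖ψ (g a) + ψ (g b)‖ < 2 := by
    have hray : ¬ SameRay ℝ (ψ (g a)) (ψ (g b)) := by
      rw [sameRay_iff_of_norm_eq (by simp [AddChar.norm_apply]), ha]
      exact fun h => hb h.symm
    have := norm_add_lt_of_not_sameRay hray
    simp only [AddChar.norm_apply] at this
    linarith
  have hb' : b ∈ Finset.univ.erase a := by simp [hab]
  rw [← Finset.add_sum_erase _ _ (Finset.mem_univ a), ← Finset.add_sum_erase _ _ hb', ← add_assoc]
  have hrest : ‖∑ w ∈ (Finset.univ.erase a).erase b, ψ (g w)‖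
      ≤ ((Finset.univ.erase a).erase b).card := by
    refine (norm_sum_le _ _).trans ?_
    simp [AddChar.norm_apply]
  have hcard : ((Finset.univ.erase a).erase b).card + 2 = Fintype.card W := by
    have h1 := Finset.card_erase_add_one (Finset.mem_univ a)
    have h2 := Finset.card_erase_add_one hb'
    rw [Finset.card_univ] at h1
    omega
  have hcard' : (((Finset.univ.erase a).erase b).card : ℝ) + 2 = Fintype.card W := by
    exact_mod_cast hcard
  have := norm_add_le (ψ (g a) + ψ (g b)) (∑ w ∈ (Finset.univ.erase a).erase b, ψ (g w))
  linarith

/-- Fourier inversion for the number of ways to write `y` as a sum of `L` values of `g`. -/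
theorem AddChar.card_mul_card_sum_eq {G W : Type*} [AddCommGroup G] [Fintype G] [Fintype W]
    (g : W → G) (y : G) (L : ℕ) :
    (Fintype.card G : ℂ) * Nat.card {v : Fin L → W // ∑ l, g (v l) = y} =
      ∑ ψ : AddChar G ℂ, ψ (-y) * (∑ w, ψ (g w)) ^ L := by
  classical
  have h : ∀ ψ : AddChar G ℂ, ψ (-y) * (∑ w, ψ (g w)) ^ L
      = ∑ v : Fin L → W, ψ (∑ l, g (v l) - y) := by
    intro ψ
    rw [← Fin.prod_const L, Finset.prod_univ_sum, Finset.mul_sum, Fintype.piFinset_univ]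
    refine Finset.sum_congr rfl fun v _ => ?_
    rw [sub_eq_neg_add, AddChar.map_add_eq_mul, AddChar.map_sum_finset]
  simp_rw [h]
  rw [Finset.sum_comm]
  simp_rw [AddChar.sum_apply_eq_ite, sub_eq_zero]
  rw [Nat.card_eq_fintype_card, Fintype.card_subtype, ← Finset.sum_filter, Finset.sum_const,
    nsmul_eq_mul, mul_comm]

/-- A random walk on a finite abelian group equidistributes if its steps `g` attain `0` and
no nontrivial character is trivial on all of them. -/
theorem tendsto_card_sum_eq_div_card {G W : Type*} [AddCommGroup G] [Fintype G] [Fintype W]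
    (g : W → G) (h₀ : ∃ w, g w = 0)
    (h₁ : ∀ ψ : AddChar G ℂ, (∀ w, ψ (g w) = 1) → ψ = 0) (y : G) :
    Tendsto (fun L : ℕ => (Nat.card {v : Fin L → W // ∑ l, g (v l) = y} : ℝ)
        / (Fintype.card W : ℝ) ^ L) atTop (nhds (1 / (Fintype.card G : ℝ))) := by
  classical
  obtain ⟨w₀, hw₀⟩ := h₀
  have : Nonempty W := ⟨w₀⟩
  have hW : (0 : ℝ) < Fintype.card W := by exact_mod_cast Fintype.card_pos
  have hWC : (Fintype.card W : ℂ) ≠ 0 := by exact_mod_cast hW.ne'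
  have hGC : (Fintype.card G : ℂ) ≠ 0 := by exact_mod_cast Fintype.card_ne_zero
  have key : Tendsto (fun L : ℕ => ∑ ψ : AddChar G ℂ,
      ψ (-y) * ((∑ w, ψ (g w)) / Fintype.card W) ^ L) atTop
      (nhds (∑ ψ : AddChar G ℂ, if ψ = 0 then 1 else 0)) := by
    refine tendsto_finsetSum _ fun ψ _ => ?_
    split_ifs with hψ
    · subst hψ
      simp [hWC]
    · rw [← mul_zero (ψ (-y))]
      refine (tendsto_pow_atTop_nhds_zero_of_norm_lt_one ?_).const_mul _
      have hne : ∃ w, ψ (g w) ≠ 1 := by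
        by_contra! h
        exact hψ (h₁ ψ h)
      rw [norm_div, Complex.norm_natCast, div_lt_one hW]
      exact ψ.norm_sum_comp_lt_card g ⟨w₀, by simp [hw₀]⟩ hne
  rw [Finset.sum_ite_eq' Finset.univ (0 : AddChar G ℂ), if_pos (Finset.mem_univ _)] at key
  have key' := key.div_const (Fintype.card G : ℂ)
  rw [← Filter.tendsto_ofReal_iff]
  push_cast
  refine key'.congr fun L => ?_
  simp_rw [div_pow, ← mul_div_assoc]
  rw [← Finset.sum_div, ← AddChar.card_mul_card_sum_eq g y L]
  simp
  field_simp

/-- A character of a finite field that is trivial on squares is trivial. -/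
theorem AddChar.apply_eq_one_of_forall_mul_self {F : Type*} [Field F] [Finite F]
    (ψ : AddChar F ℂ) (h : ∀ a, ψ (a * a) = 1) (a : F) : ψ a = 1 := by
  by_cases h2 : ringChar F = 2
  · obtain ⟨b, rfl⟩ := FiniteField.isSquare_of_char_two h2 a
    exact h b
  · have h2' : (2 : F) ≠ 0 := Ring.two_ne_zero h2
    have : a = (a + 1) / 2 * ((a + 1) / 2) - (a - 1) / 2 * ((a - 1) / 2) := by
      field_simp
      ring
    rw [this, AddChar.map_sub_eq_div, h, h, div_one]

/-- A character that is trivial on the entries-on-or-above-the-diagonal of all `w wᵀ`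
is trivial. -/
theorem AddChar.eq_zero_of_forall_mul_eq_one {F ι : Type*} [Field F] [Finite F] [Fintype ι]
    [LinearOrder ι] (ψ : AddChar ({p : ι × ι // p.1 ≤ p.2} → F) ℂ)
    (h : ∀ w : ι → F, ψ (fun p => w p.1.1 * w p.1.2) = 1) : ψ = 0 := by
  have hdiag : ∀ i a, ψ (Pi.single ⟨(i, i), le_rfl⟩ a) = 1 := by
    intro i
    let φ := ψ.compAddMonoidHom
      (AddMonoidHom.single (fun _ : {p : ι × ι // p.1 ≤ p.2} => F) ⟨(i, i), le_rfl⟩)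
    refine φ.apply_eq_one_of_forall_mul_self fun a => ?_
    rw [← h (Pi.single i a)]
    change ψ (Pi.single _ _) = _
    congr 1
    ext ⟨⟨j, k⟩, hjk⟩
    simp only [Pi.single_apply, Subtype.mk.injEq, Prod.mk.injEq]
    split_ifs <;> simp_all
  have hsingle : ∀ p a, ψ (Pi.single p a) = 1 := by
    rintro ⟨⟨i, j⟩, hij⟩ a
    obtain rfl | hlt := eq_or_lt_of_le (show i ≤ j from hij)
    · exact hdiag i a
    · have hdecomp : (fun p : {p : ι × ι // p.1 ≤ p.2} =>
            (Pi.single i a + Pi.single j 1 : ι → F) p.1.1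
              * (Pi.single i a + Pi.single j 1 : ι → F) p.1.2)
          = Pi.single ⟨(i, i), le_rfl⟩ (a * a) + Pi.single ⟨(j, j), le_rfl⟩ 1
            + Pi.single ⟨(i, j), hij⟩ a := by
        ext ⟨⟨k, l⟩, hkl⟩
        have hne := hlt.ne
        have hne' := hlt.ne'
        simp only [Pi.add_apply, Pi.single_apply, Subtype.mk.injEq, Prod.mk.injEq]
        by_cases h1 : k = i <;> by_cases h2 : k = j <;> by_cases h3 : l = i <;>
          by_cases h4 : l = j <;> simp_all
        exact absurd hkl hlt.not_ge
      have := h (Pi.single i a + Pi.single j 1)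
      rwa [hdecomp, AddChar.map_add_eq_mul, AddChar.map_add_eq_mul, hdiag, hdiag, one_mul,
        one_mul] at this
  ext v
  rw [← Finset.univ_sum_single v, AddChar.map_sum_finset]
  simp [hsingle]


/-- Lemma 3: For `W_1,…,W_K` independent uniform random vectors on `F^L`
(`F` a finite field with `q` elements) and `X^{(L)} = (⟨W_i,W_j⟩)_{1≤i≤j≤K}` their Gram
vector, for every `y ∈ F^m` (`m = K(K+1)/2`) we have
`lim_{L→∞} Pr{X^{(L)} = y} = q^{−m}`. -/
theorem stmt5 (F : Type*) [Field F] [Fintype F] (K : ℕ) (hK : 1 ≤ K)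
    (y : {p : Fin K × Fin K // p.1 ≤ p.2} → F) :
    Tendsto (fun L : ℕ =>
        (Nat.card {w : Fin K → Fin L → F //
            (fun p : {p : Fin K × Fin K // p.1 ≤ p.2} =>
              ∑ ℓ, w p.1.1 ℓ * w p.1.2 ℓ) = y} : ℝ)
          / (Fintype.card (Fin K → Fin L → F) : ℝ))
      atTop
      (nhds (1 / (Fintype.card F : ℝ) ^ (K * (K + 1) / 2))) := by

  classical
  let g : (Fin K → F) → {p : Fin K × Fin K // p.1 ≤ p.2} → F := fun w p => w p.1.1 * w p.1.2
  have hcard : Fintype.card ({p : Fin K × Fin K // p.1 ≤ p.2} → F)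
      = Fintype.card F ^ (K * (K + 1) / 2) := by
    rw [Fintype.card_fun, ← Fintype.card_congr (Sym2.sortEquiv (α := Fin K)), Sym2.card,
      Fintype.card_fin, Nat.choose_two_right, Nat.add_sub_cancel, mul_comm (K + 1)]
  have key := tendsto_card_sum_eq_div_card g ⟨0, by ext; simp [g]⟩
    (fun ψ hψ => ψ.eq_zero_of_forall_mul_eq_one hψ) y
  rw [hcard, Nat.cast_pow] at key
  refine key.congr fun L => ?_
  have hfun : Fintype.card (Fin K → Fin L → F) = Fintype.card (Fin K → F) ^ L := by
    rw [Fintype.card_congr (Equiv.piComm fun (_ : Fin K) (_ : Fin L) => F), Fintype.card_fun,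
      Fintype.card_fin]
  rw [hfun, Nat.cast_pow]
  congr 2
  refine Nat.card_congr ((Equiv.piComm fun (_ : Fin L) (_ : Fin K) => F).subtypeEquiv fun v => ?_)
  simp [funext_iff, g, Finset.sum_apply, Function.swap]
end

section
/- Let F_q be a finite field with q elements, K ≥ 1, and let 𝒫 be a set of P unordered pairs {i,j} with i,j ∈ {1,…,K}. For each L ≥ 1 let X^{(L)}_𝒫 be the vector of inner products (⟨W_i,W_j⟩)_{\{i,j\}∈𝒫}, where W_1,…,W_K are independent uniform random vectors on F_q^L. Then there exist C ≥ 0 and λ ∈ [0,1) such that for every L ≥ 1, the Shannon entropy satisfies H(X^{(L)}_𝒫) ≥ P·log q − C·λ^{L−1}. -/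
open Finset in
/-- A sum of unit complex numbers that are not all equal to `1`, one of which is `1`,
has norm smaller than the number of terms. -/
theorem norm_sum_lt_card_of_ne {α : Type*} [Fintype α] (g : α → ℂ) (hg : ∀ x, ‖g x‖ = 1)
    {a b : α} (ha : g a = 1) (hb : g b ≠ 1) : ‖∑ x, g x‖ < Fintype.card α := by
  classical
  have hab : b ≠ a := by rintro rfl; exact hb ha
  have hpair : ‖g a + g b‖ < 2 := by
    have hray : ¬ SameRay ℝ (g a) (g b) := by
      rw [sameRay_iff_of_norm_eq (by rw [hg, hg]), ha]
      exact hb.symm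
    have := norm_add_lt_of_not_sameRay hray
    rw [hg, hg] at this
    linarith
  have hmem : b ∈ univ.erase a := by simp [hab]
  have hrest : ‖∑ x ∈ (univ.erase a).erase b, g x‖ ≤ #((univ.erase a).erase b) := by
    refine (norm_sum_le _ _).trans (le_of_eq ?_)
    simp [hg]
  have hcard : (#((univ.erase a).erase b) : ℝ) + 2 = Fintype.card α := by
    rw [← card_univ, ← card_erase_add_one (mem_univ a), ← card_erase_add_one hmem]
    push_cast
    ring
  rw [← add_sum_erase _ _ (mem_univ a), ← add_sum_erase _ _ hmem, ← add_assoc]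
  linarith [norm_add_le (g a + g b) (∑ x ∈ (univ.erase a).erase b, g x)]

/-- If `f` vanishes somewhere and its image is contained in the kernel of no nontrivial character,
then the Fourier coefficients of the law of `f` at nontrivial characters are uniformly
bounded away from `1`. -/
theorem exists_norm_sum_addChar_le {α G : Type*} [Fintype α] [AddCommGroup G] [Finite G]
    (f : α → G) {a : α} (ha : f a = 0)
    (hf : ∀ χ : AddChar G ℂ, (∀ x, χ (f x) = 1) → χ = 1) :
    ∃ lam : ℝ, 0 ≤ lam ∧ lam < 1 ∧
      ∀ χ : AddChar G ℂ, χ ≠ 1 → ‖∑ x, χ (f x)‖ ≤ lam * Fintype.card α := by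
  classical
  have : Fintype G := Fintype.ofFinite _
  have hpos : (0 : ℝ) < Fintype.card α := by
    exact_mod_cast Fintype.card_pos_iff.mpr ⟨a⟩
  let c : AddChar G ℂ → NNReal := fun χ => ‖∑ x, χ (f x)‖₊ / Fintype.card α
  refine ⟨((Finset.univ.filter (fun χ : AddChar G ℂ => χ ≠ 1)).sup c : NNReal), NNReal.coe_nonneg _, ?_, fun χ hχ => ?_⟩
  · rw [← NNReal.coe_one, NNReal.coe_lt_coe, Finset.sup_lt_iff (by simp)]
    intro χ hχ
    obtain ⟨b, hb⟩ : ∃ b, χ (f b) ≠ 1 := by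
      by_contra! h
      exact (Finset.mem_filter.mp hχ).2 (hf χ h)
    have h := norm_sum_lt_card_of_ne (fun x => χ (f x)) (fun x => AddChar.norm_apply χ _)
      (show χ (f a) = 1 by rw [ha, AddChar.map_zero_eq_one]) hb
    rw [← NNReal.coe_lt_coe]
    simp only [c, NNReal.coe_div, NNReal.coe_natCast, coe_nnnorm, NNReal.coe_one]
    exact (div_lt_one hpos).mpr h
  · have h : c χ ≤ (Finset.univ.filter (fun χ : AddChar G ℂ => χ ≠ 1)).sup c :=
      Finset.le_sup (by simp [hχ])
    rw [← NNReal.coe_le_coe] at h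
    simpa [c, div_le_iff₀ hpos] using h

/-- Fourier inversion bound for the law of a sum of `L` independent copies of `f`. -/
theorem card_mul_card_sum_eq_le {α G : Type*} [Fintype α] [AddCommGroup G] [Fintype G]
    (f : α → G) {lam : ℝ}
    (hf : ∀ χ : AddChar G ℂ, χ ≠ 1 → ‖∑ x, χ (f x)‖ ≤ lam * Fintype.card α)
    (hlam : 0 ≤ lam) (L : ℕ) (z : G) :
    (Fintype.card G : ℝ) * Nat.card {v : Fin L → α // ∑ l, f (v l) = z} ≤
      (1 + Fintype.card G * lam ^ L) * (Fintype.card α : ℝ) ^ L := by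
  classical
  have key : (Fintype.card G : ℂ) * Nat.card {v : Fin L → α // ∑ l, f (v l) = z} =
      ∑ χ : AddChar G ℂ, χ (-z) * (∑ x, χ (f x)) ^ L := by
    have hχ (χ : AddChar G ℂ) : χ (-z) * (∑ x, χ (f x)) ^ L =
        ∑ v : Fin L → α, χ (∑ l, f (v l) - z) := by
      rw [Fintype.sum_pow, Finset.mul_sum]
      refine Finset.sum_congr rfl fun v _ => ?_
      rw [sub_eq_neg_add, AddChar.map_add_eq_mul]
      congr 1
      exact (map_prod χ.toMonoidHom (fun l => Multiplicative.ofAdd (f (v l))) Finset.univ).symm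
    simp_rw [hχ]
    rw [Finset.sum_comm]
    simp_rw [AddChar.sum_apply_eq_ite, sub_eq_zero]
    rw [← Finset.sum_filter, Finset.sum_const, nsmul_eq_mul, Nat.card_eq_fintype_card,
      Fintype.card_subtype, mul_comm]
  have hcard : (Fintype.card (AddChar G ℂ) : ℝ) = Fintype.card G := by
    simp [AddChar.card_eq]
  have hA : (0 : ℝ) ≤ Fintype.card α := Nat.cast_nonneg _
  calc (Fintype.card G : ℝ) * Nat.card {v : Fin L → α // ∑ l, f (v l) = z}
      = ‖∑ χ : AddChar G ℂ, χ (-z) * (∑ x, χ (f x)) ^ L‖ := by rw [← key]; simp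
    _ ≤ ∑ χ : AddChar G ℂ, ‖χ (-z) * (∑ x, χ (f x)) ^ L‖ := norm_sum_le _ _
    _ ≤ ∑ χ : AddChar G ℂ, ((if χ = 1 then (Fintype.card α : ℝ) ^ L else 0) +
          (lam * Fintype.card α) ^ L) := by
        refine Finset.sum_le_sum fun χ _ => ?_
        rw [norm_mul, AddChar.norm_apply, one_mul, norm_pow]
        split_ifs with h
        · subst h
          simp only [AddChar.one_apply, Finset.sum_const, Finset.card_univ, nsmul_eq_mul, mul_one,
            Complex.norm_natCast]
          linarith [pow_nonneg (mul_nonneg hlam hA) L]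
        · rw [zero_add]
          exact pow_le_pow_left₀ (norm_nonneg _) (hf χ h) L
    _ = (1 + Fintype.card G * lam ^ L) * (Fintype.card α : ℝ) ^ L := by
        rw [Finset.sum_add_distrib, Finset.sum_ite_eq', Finset.sum_const, Finset.card_univ,
          nsmul_eq_mul, hcard, mul_pow]
        simp only [Finset.mem_univ, if_true]
        ring

/-- A probability vector whose entries are at most `(1 + ε) / N` has entropy at least
`log N - ε`. -/
theorem log_card_sub_le_sum_negMulLog {G : Type*} [Fintype G] [Nonempty G] (p : G → ℝ)
    (hp : ∀ z, 0 ≤ p z) (hsum : ∑ z, p z = 1) {ε : ℝ}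
    (hε : ∀ z, Fintype.card G * p z ≤ 1 + ε) :
    Real.log (Fintype.card G) - ε ≤ ∑ z, Real.negMulLog (p z) := by
  have hN : (0 : ℝ) < Fintype.card G := by exact_mod_cast Fintype.card_pos
  calc Real.log (Fintype.card G) - ε
      = ∑ z, p z * (Real.log (Fintype.card G) - ε) := by rw [← Finset.sum_mul, hsum, one_mul]
    _ ≤ ∑ z, Real.negMulLog (p z) := by
        refine Finset.sum_le_sum fun z _ => ?_
        rcases (hp z).eq_or_lt with h | h
        · simp [← h]
        · have hlog := Real.log_le_sub_one_of_pos (mul_pos hN h)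
          rw [Real.log_mul hN.ne' h.ne'] at hlog
          have := mul_le_mul_of_nonneg_left
            (show Real.log (Fintype.card G) - ε ≤ -Real.log (p z) by linarith [hε z]) h.le
          rw [Real.negMulLog]
          linarith

/-- Every element of a finite field lies in the additive subgroup generated by the squares. -/
theorem FiniteField.mem_of_forall_sq_mem {F : Type*} [Field F] [Finite F] (H : AddSubgroup F)
    (hH : ∀ t : F, t * t ∈ H) (c : F) : c ∈ H := by
  have : Fintype F := Fintype.ofFinite F
  by_cases h : ringChar F = 2
  · obtain ⟨t, rfl⟩ := FiniteField.isSquare_of_char_two h c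
    exact hH t
  · have h2 : (2 : F) ≠ 0 := Ring.two_ne_zero h
    have hc : c = (c / 4 + 1) * (c / 4 + 1) - (c / 4 - 1) * (c / 4 - 1) := by
      have h4 : (4 : F) ≠ 0 := by
        have : (4 : F) = 2 * 2 := by norm_num
        rw [this]
        exact mul_ne_zero h2 h2
      field_simp
      ring
    rw [hc]
    exact H.sub_mem (hH _) (hH _)

/-- The vectors of products `(x i * x j)` indexed by distinct unordered pairs `{i, j}` generate
the whole additive group of vectors over a finite field. -/
theorem FiniteField.mem_of_forall_pairProd_mem {F ι : Type*} [Field F] [Finite F] [LinearOrder ι]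
    (Ps : Finset {p : ι × ι // p.1 ≤ p.2}) (H : AddSubgroup (↥Ps → F))
    (hH : ∀ x : ι → F, (fun s : ↥Ps => x s.1.1.1 * x s.1.1.2) ∈ H) (g : ↥Ps → F) : g ∈ H := by
  classical
  have hsingle (s : ↥Ps) (c : F) : Pi.single s c ∈ H := by
    obtain ⟨⟨⟨i, j⟩, hij⟩, hs⟩ := s
    dsimp only at hij
    rcases hij.eq_or_lt with rfl | hlt
    · refine FiniteField.mem_of_forall_sq_mem
        (H.comap (AddMonoidHom.single (fun _ : ↥Ps => F) ⟨⟨⟨i, i⟩, hij⟩, hs⟩)) (fun t => ?_) c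
      rw [AddSubgroup.mem_comap]
      convert hH (Pi.single i t) using 1
      ext ⟨⟨⟨a, b⟩, hab⟩, hs'⟩
      simp only [AddMonoidHom.single_apply, Pi.single_apply, Subtype.mk.injEq, Prod.mk.injEq]
      grind
    · have h := H.sub_mem (H.sub_mem (hH (Pi.single i c + Pi.single j 1)) (hH (Pi.single i c)))
        (hH (Pi.single j 1))
      convert h using 1
      ext ⟨⟨⟨a, b⟩, hab⟩, hs'⟩
      dsimp only at hab
      simp only [Pi.sub_apply, Pi.add_apply, Pi.single_apply, Subtype.mk.injEq, Prod.mk.injEq]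
      have := hlt.ne
      have : ¬ (a = j ∧ b = i) := fun h => absurd hlt (by rw [← h.1, ← h.2]; exact hab.not_gt)
      by_cases h1 : a = i <;> by_cases h2 : b = j <;> by_cases h3 : a = j <;>
        by_cases h4 : b = i <;> simp_all
  rw [← Finset.univ_sum_single g]
  exact H.sum_mem fun s _ => hsingle s _


/-- Lemma 5: Let `Ps` be a set of `P` unordered pairs of indices from
`{1,…,K}` and `X^{(L)}_Ps = (⟨W_i,W_j⟩)_{{i,j}∈Ps}` with `W_1,…,W_K` independent uniform on
`F^L` (`F` a finite field with `q` elements).  Then there exist `C ≥ 0` and `λ ∈ [0,1)` such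
that for every `L ≥ 1` the Shannon entropy (natural logarithm) satisfies
`H(X^{(L)}_Ps) ≥ P·log q − C·λ^{L−1}`. -/
theorem stmt8 (F : Type*) [Field F] [Fintype F] (K P : ℕ) (hK : 1 ≤ K)
    (Ps : Finset {p : Fin K × Fin K // p.1 ≤ p.2}) (hP : Ps.card = P) :
    ∃ C : ℝ, 0 ≤ C ∧ ∃ lam : ℝ, 0 ≤ lam ∧ lam < 1 ∧
      ∀ L : ℕ, 1 ≤ L →
        ∑ z : ↥Ps → F,
            Real.negMulLog
              ((Nat.card {w : Fin K → Fin L → F //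
                  (fun s : ↥Ps => ∑ ℓ, w s.1.1.1 ℓ * w s.1.1.2 ℓ) = z} : ℝ)
                / (Fintype.card (Fin K → Fin L → F) : ℝ))
          ≥ (P : ℝ) * Real.log (Fintype.card F) - C * lam ^ (L - 1) := by
  classical
  let G := ↥Ps → F
  let f : (Fin K → F) → G := fun x s => x s.1.1.1 * x s.1.1.2
  obtain ⟨lam, h0, h1, hlam⟩ := exists_norm_sum_addChar_le f (a := 0) (by ext s; exact zero_mul _)
    (fun χ hχ => by
      ext g
      have hg := FiniteField.mem_of_forall_pairProd_mem Ps χ.toAddMonoidHom.ker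
        (fun x => (AddMonoidHom.mem_ker).mpr (congrArg Additive.ofMul (hχ x))) g
      exact congrArg Additive.toMul ((AddMonoidHom.mem_ker).mp hg))
  refine ⟨Fintype.card G, Nat.cast_nonneg _, lam, h0, h1, fun L _ => ?_⟩
  have hT : (0 : ℝ) < Fintype.card (Fin K → Fin L → F) := by exact_mod_cast Fintype.card_pos
  have hcard (z : G) : Nat.card {w : Fin K → Fin L → F //
        (fun s : ↥Ps => ∑ ℓ, w s.1.1.1 ℓ * w s.1.1.2 ℓ) = z} =
      Nat.card {v : Fin L → Fin K → F // ∑ l, f (v l) = z} := by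
    refine Nat.card_congr ((Equiv.piComm fun _ _ => F).subtypeEquiv fun w => ?_)
    refine Eq.congr_left ?_
    ext s
    exact (Finset.sum_apply s Finset.univ fun l => f (Function.swap w l)).symm
  have hTL : (Fintype.card (Fin K → Fin L → F) : ℝ) = (Fintype.card (Fin K → F) : ℝ) ^ L := by
    rw [Fintype.card_congr (Equiv.piComm fun _ _ => F), Fintype.card_fun, Fintype.card_fin]
    push_cast
    rfl
  have hlog : (P : ℝ) * Real.log (Fintype.card F) = Real.log (Fintype.card G) := by
    simp [G, hP]
  rw [hlog, ge_iff_le]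
  refine log_card_sub_le_sum_negMulLog _ (fun z => by positivity) ?_ fun z => ?_
  · rw [← Finset.sum_div, div_eq_one_iff_eq hT.ne', ← Nat.cast_sum]
    simp_rw [Nat.card_eq_fintype_card]
    rw [← Fintype.card_sigma, Fintype.card_congr (Equiv.sigmaFiberEquiv _)]
  · have h := card_mul_card_sum_eq_le f hlam h0 L z
    have hmono : lam ^ L ≤ lam ^ (L - 1) := pow_le_pow_of_le_one h0 h1.le (Nat.sub_le _ _)
    rw [hcard, ← mul_div_assoc, div_le_iff₀ hT, hTL]
    refine h.trans ?_
    gcongr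
end
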